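/- arXiv:1901.04142 — 7 statements merged into one kernel-verified Lean document; each statement's English description precedes it below -/
import Mathlib

section
/- Let (X,→) be a finite set equipped with a strict partial order → and let ≺ be a planar order on (X,→). Define a relation < on X by: x < y if and only if x ≺ y and ¬(x → y). Then < is a strict partial order on X that is conjugate to →, i.e., for every pair of distinct elements x,y ∈ X, exactly one of the four relations x→y, y→x, x<y, y<x holds. -/
/-- A strict linear order: irreflexive, transitive, and any two distinct
elements are comparable. -/
def IsStrictLinearOrder {X : Type*} (prec : X → X → Prop) : Prop :=
  (∀ x, ¬ prec x x) ∧ (∀ x y z, prec x y → prec y z → prec x z) ∧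
    ∀ x y, x ≠ y → prec x y ∨ prec y x

/-- A strict partial order: irreflexive and transitive. -/
def IsStrictPartialOrder' {X : Type*} (r : X → X → Prop) : Prop :=
  (∀ x, ¬ r x x) ∧ ∀ x y z, r x y → r y z → r x z

/-- A planar order on `(X, r)`: a strict linear order `prec` satisfying
(P1) `r x y → prec x y` and (P2) `prec x1 x2 → prec x2 x3 → r x1 x3 →
r x1 x2 ∨ r x2 x3`. -/
def IsPlanarOrder {X : Type*} (r prec : X → X → Prop) : Prop :=
  IsStrictLinearOrder prec ∧ (∀ x y, r x y → prec x y) ∧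
    ∀ x1 x2 x3, prec x1 x2 → prec x2 x3 → r x1 x3 → r x1 x2 ∨ r x2 x3

/-- Exactly one of the four propositions holds. -/
def ExactlyOne4 (a b c d : Prop) : Prop :=
  (a ∨ b ∨ c ∨ d) ∧ (a → ¬b ∧ ¬c ∧ ¬d) ∧ (b → ¬a ∧ ¬c ∧ ¬d) ∧
    (c → ¬a ∧ ¬b ∧ ¬d) ∧ (d → ¬a ∧ ¬b ∧ ¬c)

theorem stmt2 {X : Type*} [Fintype X] (r prec : X → X → Prop)
    (hr : IsStrictPartialOrder' r) (hpo : IsPlanarOrder r prec) :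
    IsStrictPartialOrder' (fun x y => prec x y ∧ ¬ r x y) ∧
      ∀ x y, x ≠ y →
        ExactlyOne4 (r x y) (r y x) (prec x y ∧ ¬ r x y) (prec y x ∧ ¬ r y x) := by
  obtain ⟨⟨hi, ht, hl⟩, h1, h2⟩ := hpo
  refine ⟨⟨fun x h => hi x h.1, ?_⟩, ?_⟩
  · rintro x y z ⟨hxy, nxy⟩ ⟨hyz, nyz⟩
    refine ⟨ht x y z hxy hyz, fun h => ?_⟩
    rcases h2 x y z hxy hyz h with h | h
    · exact nxy h
    · exact nyz h
  · intro x y hne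
    have ha : prec x y → prec y x → False := fun a b => hi x (ht x y x a b)
    have hb := hl x y hne
    have hc := h1 x y
    have hd := h1 y x
    unfold ExactlyOne4
    tauto
end

section
/- Let X be a finite set and let → and < be two strict partial orders on X that are conjugate, i.e., for every pair of distinct elements x,y ∈ X exactly one of x→y, y→x, x<y, y<x holds. Define ≺ on X by: x ≺ y if and only if x→y or x<y. Then ≺ is a planar order on (X,→). -/
theorem stmt3 {X : Type*} [Fintype X] (r lt : X → X → Prop)
    (hr : IsStrictPartialOrder' r) (hlt : IsStrictPartialOrder' lt)
    (hconj : ∀ x y, x ≠ y → ExactlyOne4 (r x y) (r y x) (lt x y) (lt y x)) :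
    IsPlanarOrder r (fun x y => r x y ∨ lt x y) := by
  obtain ⟨ri, rt⟩ := hr
  obtain ⟨li, ltt⟩ := hlt
  have ex : ∀ x y, r x y → ¬ lt x y ∧ ¬ lt y x := by
    intro x y h
    have hne : x ≠ y := fun e => ri y (e ▸ h)
    exact ((hconj x y hne).2.1 h).2
  have tot : ∀ x y, x ≠ y → r x y ∨ r y x ∨ lt x y ∨ lt y x :=
    fun x y h => (hconj x y h).1
  refine ⟨⟨?_, ?_, ?_⟩, fun x y h => Or.inl h, ?_⟩
  · rintro x (h | h)
    · exact ri x h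
    · exact li x h
  · rintro x y z (h1 | h1) (h2 | h2)
    · exact Or.inl (rt x y z h1 h2)
    · have hne : x ≠ z := by
        rintro rfl
        exact (ex _ _ h1).2 h2
      rcases tot x z hne with h | h | h | h
      · exact Or.inl h
      · exact absurd h2 (ex _ _ (rt _ _ _ h h1)).2
      · exact Or.inr h
      · exact absurd (ltt _ _ _ h2 h) (ex _ _ h1).2
    · have hne : x ≠ z := by
        rintro rfl
        exact (ex _ _ h2).2 h1
      rcases tot x z hne with h | h | h | h
      · exact Or.inl h
      · exact absurd h1 (ex _ _ (rt _ _ _ h2 h)).2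
      · exact Or.inr h
      · exact absurd (ltt _ _ _ h h1) (ex _ _ h2).2
    · exact Or.inr (ltt x y z h1 h2)
  · intro x y h
    rcases tot x y h with h | h | h | h
    · exact Or.inl (Or.inl h)
    · exact Or.inr (Or.inl h)
    · exact Or.inl (Or.inr h)
    · exact Or.inr (Or.inr h)
  · rintro x y z (h1 | h1) (h2 | h2) h
    · exact Or.inl h1
    · exact Or.inl h1
    · exact Or.inr h2
    · exact absurd (ltt _ _ _ h1 h2) (ex _ _ h).1
end

section
/- Let (G,≺) be a POP-graph and let v be a vertex of G whose degree (number of incident edges, counting an edge once for each incidence) is not equal to one. Then I(v) and O(v) are both nonempty, i⁺(v) ≺ o⁻(v), and there is no edge e of G with i⁺(v) ≺ e ≺ o⁻(v); in other words, o⁻(v) is the immediate successor of i⁺(v) in the linear order ≺ on E(G). -/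
/-- A list of edges is a chain if consecutive edges are head-to-tail:
the target of each edge is the source of the next. -/
def EdgeChain {V E : Type*} (s t : E → V) (p : List E) : Prop :=
  List.Chain' (fun a b => t a = s b) p

/-- Vertex reachability: there is a nonempty directed path of edges starting
at `v` and ending at `w`. -/
def VReach {V E : Type*} (s t : E → V) (v w : V) : Prop :=
  ∃ (e : E) (p : List E), EdgeChain s t (e :: p) ∧ s e = v ∧
    t ((e :: p).getLast (List.cons_ne_nil _ _)) = w

/-- The edge-poset relation: `e → f` iff `e ≠ f` and there is a directed path
whose first edge is `e` and whose last edge is `f`. -/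
def EReach {V E : Type*} (s t : E → V) (e f : E) : Prop :=
  e ≠ f ∧ ∃ p : List E, EdgeChain s t (e :: p) ∧
    (e :: p).getLast (List.cons_ne_nil _ _) = f

/-- The graph is acyclic: no vertex reaches itself. -/
def Acyclic {V E : Type*} (s t : E → V) : Prop :=
  ∀ v, ¬ VReach s t v v

/-- The degree of a vertex: the number of incident edges, counting an edge
once for each incidence. -/
noncomputable def degree {V E : Type*} [Fintype E] (s t : E → V) (v : V) : ℕ :=
  Nat.card {e : E // s e = v} + Nat.card {e : E // t e = v}

/-- A processive graph: a finite acyclic directed multigraph in which every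
source and every sink has exactly one incident edge. -/
def Processive {V E : Type*} [Fintype E] (s t : E → V) : Prop :=
  Acyclic s t ∧
    (∀ v : V, (∀ e, t e ≠ v) → degree s t v = 1) ∧
    (∀ v : V, (∀ e, s e ≠ v) → degree s t v = 1)

/-- `m` is the maximum, with respect to the strict order `prec`, of the set
of elements satisfying `P`. -/
def IsMaxIn {X : Type*} (prec : X → X → Prop) (P : X → Prop) (m : X) : Prop :=
  P m ∧ ∀ x, P x → x = m ∨ prec x m

/-- `m` is the minimum, with respect to the strict order `prec`, of the set
of elements satisfying `P`. -/
def IsMinIn {X : Type*} (prec : X → X → Prop) (P : X → Prop) (m : X) : Prop :=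
  P m ∧ ∀ x, P x → x = m ∨ prec m x

/-- `x ⪯ y`: `x = y` or `x ≺ y`. -/
def WeakPrec {X : Type*} (prec : X → X → Prop) (x y : X) : Prop :=
  x = y ∨ prec x y

/-- The induced relation `≺_V` on vertices: `v1 ≺_V v2` iff `v1 ≠ v2` and
(1) `i⁺(v1) ≺ i⁺(v2)`, or (2) `i⁺(v1) ≺ o⁻(v2)`, or (3) `o⁻(v1) ⪯ i⁺(v2)`,
or (4) `o⁻(v1) ≺ o⁻(v2)`, whenever the relevant maxima/minima exist. -/
def VPrec {V E : Type*} (s t : E → V) (prec : E → E → Prop) (v1 v2 : V) : Prop :=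
  v1 ≠ v2 ∧
    ((∃ i1 i2, IsMaxIn prec (fun e => t e = v1) i1 ∧
        IsMaxIn prec (fun e => t e = v2) i2 ∧ prec i1 i2) ∨
     (∃ i1 o2, IsMaxIn prec (fun e => t e = v1) i1 ∧
        IsMinIn prec (fun e => s e = v2) o2 ∧ prec i1 o2) ∨
     (∃ o1 i2, IsMinIn prec (fun e => s e = v1) o1 ∧
        IsMaxIn prec (fun e => t e = v2) i2 ∧ WeakPrec prec o1 i2) ∨
     (∃ o1 o2, IsMinIn prec (fun e => s e = v1) o1 ∧
        IsMinIn prec (fun e => s e = v2) o2 ∧ prec o1 o2))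

theorem stmt4 {V E : Type*} [Fintype V] [Fintype E] (s t : E → V)
    (prec : E → E → Prop)
    (hproc : Processive s t) (hpo : IsPlanarOrder (EReach s t) prec)
    (v : V) (hdeg : degree s t v ≠ 1) :
    (∃ e, t e = v) ∧ (∃ e, s e = v) ∧
      ∀ ip om, IsMaxIn prec (fun e => t e = v) ip →
        IsMinIn prec (fun e => s e = v) om →
          prec ip om ∧ ¬ ∃ e, prec ip e ∧ prec e om := by
  obtain ⟨hac, hsrc, hsnk⟩ := hproc
  obtain ⟨⟨hirr, htrans, -⟩, hP1, hP2⟩ := hpo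
  refine ⟨?_, ?_, ?_⟩
  · by_contra h
    exact hdeg (hsrc v fun e he => h ⟨e, he⟩)
  · by_contra h
    exact hdeg (hsnk v fun e he => h ⟨e, he⟩)
  · rintro ip om ⟨hip, hmax⟩ ⟨hom, hmin⟩
    simp only at hip hom hmax hmin
    have hne : ip ≠ om := by
      rintro rfl
      refine hac v ⟨ip, [], ?_, hom, ?_⟩
      · exact List.isChain_singleton _
      · simpa using hip
    have hr : EReach s t ip om := by
      refine ⟨hne, [om], ?_, by simp⟩
      exact List.isChain_pair.2 (hip.trans hom.symm)
    refine ⟨hP1 _ _ hr, ?_⟩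
    rintro ⟨e, h1, h2⟩
    rcases hP2 _ _ _ h1 h2 hr with ⟨hn, p, hc, hl⟩ | ⟨hn, p, hc, hl⟩
    · -- a path from `ip` to `e` starts with `ip, f` where `s f = v`
      cases p with
      | nil => exact hn (by simpa using hl)
      | cons f q =>
        have hc' := List.isChain_cons_cons.1 hc
        have hf : s f = v := hc'.1.symm.trans hip
        have hfe : f = e ∨ prec f e := by
          by_cases h : f = e
          · exact Or.inl h
          · exact Or.inr (hP1 _ _ ⟨h, q, hc'.2, by simpa using hl⟩)
        have hoe : om = e ∨ prec om e := by
          rcases hmin f hf with rfl | h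
          · exact hfe
          · rcases hfe with rfl | h'
            · exact Or.inr h
            · exact Or.inr (htrans _ _ _ h h')
        rcases hoe with rfl | h
        · exact hirr _ h2
        · exact hirr _ (htrans _ _ _ h h2)
    · -- a path from `e` to `om` ends with `g, om` where `t g = v`
      rcases List.eq_nil_or_concat p with rfl | ⟨q, b, rfl⟩
      · exact hn (by simpa using hl)
      · have hb : b = om := by simpa using hl
        subst hb
        have hc0 : List.IsChain (fun a b => t a = s b) ((e :: q) ++ [b]) := by
          have hc1 : List.IsChain (fun a b => t a = s b) (e :: q.concat b) := hc
          simpa using hc1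
        have hc' := List.isChain_append.1 hc0
        set g := (e :: q).getLast (List.cons_ne_nil _ _) with hg
        have htg : t g = v := by
          have := hc'.2.2 g (by rw [List.getLast?_eq_some_getLast (List.cons_ne_nil _ _)]; simp [hg]) b (by simp)
          exact this.trans hom
        have heg : e = g ∨ prec e g := by
          by_cases h : e = g
          · exact Or.inl h
          · exact Or.inr (hP1 _ _ ⟨h, q, hc'.1, hg.symm⟩)
        have hei : e = ip ∨ prec e ip := by
          rcases hmax g htg with h | h
          · rw [← h]; exact heg
          · rcases heg with h' | h'
            · rw [h']; exact Or.inr h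
            · exact Or.inr (htrans _ _ _ h' h)
        rcases hei with rfl | h
        · exact hirr _ h1
        · exact hirr _ (htrans _ _ _ h h1)
end

section
/- Let (G,≺) be a POP-graph and let v be a vertex of G with both I(v) and O(v) nonempty. Write i⁻(v), i⁺(v) for the ≺-minimum and ≺-maximum of I(v), and o⁻(v), o⁺(v) for the ≺-minimum and ≺-maximum of O(v). Then the ≺-interval determined by the incident edges of v is the disjoint union of the interval determined by I(v) and the interval determined by O(v): every edge e with i⁻(v) ⪯ e ⪯ o⁺(v) satisfies either i⁻(v) ⪯ e ⪯ i⁺(v) or o⁻(v) ⪯ e ⪯ o⁺(v), and no edge satisfies both. -/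
theorem chain_rtg {V E : Type*} (s t : E → V) (p : List E) : ∀ e : E, EdgeChain s t (e :: p) →
    Relation.ReflTransGen (fun a b => t a = s b) e
      ((e :: p).getLast (List.cons_ne_nil _ _)) := by
  induction p with
  | nil => intro e _; exact Relation.ReflTransGen.refl
  | cons a p ih =>
    intro e h
    have h' : t e = s a ∧ EdgeChain s t (a :: p) := by
      unfold EdgeChain at h ⊢
      exact List.isChain_cons_cons.mp h
    rw [List.getLast_cons (List.cons_ne_nil _ _)]
    exact Relation.ReflTransGen.head h'.1 (ih a h'.2)

theorem stmt5 {V E : Type*} [Fintype V] [Fintype E] (s t : E → V)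
    (prec : E → E → Prop)
    (hproc : Processive s t) (hpo : IsPlanarOrder (EReach s t) prec)
    (v : V) (hI : ∃ e, t e = v) (hO : ∃ e, s e = v) :
    ∀ im ip om op,
      IsMinIn prec (fun e => t e = v) im → IsMaxIn prec (fun e => t e = v) ip →
      IsMinIn prec (fun e => s e = v) om → IsMaxIn prec (fun e => s e = v) op →
        (∀ e, WeakPrec prec im e → WeakPrec prec e op →
          (WeakPrec prec im e ∧ WeakPrec prec e ip) ∨
          (WeakPrec prec om e ∧ WeakPrec prec e op)) ∧
        (∀ e, ¬ ((WeakPrec prec im e ∧ WeakPrec prec e ip) ∧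
          (WeakPrec prec om e ∧ WeakPrec prec e op))) := by
  intro im ip om op him hip hom hop
  obtain ⟨hac, -⟩ := hproc
  obtain ⟨⟨hirr, htr, htot⟩, hP1, hP2⟩ := hpo
  have hstep : ∀ a b, t a = s b → EReach s t a b := by
    intro a b hab
    refine ⟨?_, [b], ?_, rfl⟩
    · rintro rfl
      exact hac (s a) ⟨a, [], List.isChain_singleton a, rfl, hab⟩
    · exact List.isChain_cons_cons.mpr ⟨hab, List.isChain_singleton b⟩
  have hw : ∀ a b, Relation.ReflTransGen (fun a b => t a = s b) a b → WeakPrec prec a b := by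
    intro a b h
    induction h with
    | refl => exact Or.inl rfl
    | tail _ hbc ih =>
      have := hP1 _ _ (hstep _ _ hbc)
      rcases ih with rfl | ih
      · exact Or.inr this
      · exact Or.inr (htr _ _ _ ih this)
  have hio : EReach s t ip om := hstep _ _ (hip.1.trans hom.1.symm)
  have hio' := hP1 _ _ hio
  constructor
  · intro e h1 h2
    by_cases h3 : WeakPrec prec e ip
    · exact Or.inl ⟨h1, h3⟩
    by_cases h4 : WeakPrec prec om e
    · exact Or.inr ⟨h4, h2⟩
    exfalso
    have h5 : prec ip e := (htot ip e (fun h => h3 (Or.inl h.symm))).resolve_right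
      (fun h => h3 (Or.inr h))
    have h6 : prec e om := (htot e om (fun h => h4 (Or.inl h.symm))).resolve_right
      (fun h => h4 (Or.inr h))
    rcases hP2 _ _ _ h5 h6 hio with ⟨hne, p, hc, hl⟩ | ⟨hne, p, hc, hl⟩
    · have h := chain_rtg s t p _ hc
      rw [hl] at h
      rcases Relation.ReflTransGen.cases_head h with h | ⟨f, hf, hfe⟩
      · exact hne h
      · apply h4
        have hsf : s f = v := hf.symm.trans hip.1
        rcases hom.2 f hsf with rfl | hof
        · exact hw _ _ hfe
        · rcases hw _ _ hfe with rfl | h7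
          · exact Or.inr hof
          · exact Or.inr (htr _ _ _ hof h7)
    · have h := chain_rtg s t p _ hc
      rw [hl] at h
      rcases Relation.ReflTransGen.cases_tail h with h | ⟨f, hef, hf⟩
      · exact hne h.symm
      · apply h3
        have htf : t f = v := hf.trans hom.1
        rcases hip.2 f htf with rfl | hof
        · exact hw _ _ hef
        · rcases hw _ _ hef with rfl | h7
          · exact Or.inr hof
          · exact Or.inr (htr _ _ _ h7 hof)
  · rintro e ⟨⟨-, h1⟩, h2, -⟩
    apply hirr om
    rcases h1 with rfl | h1 <;> rcases h2 with rfl | h2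
    · exact hio'
    · exact htr _ _ _ h2 hio'
    · exact htr _ _ _ h1 hio'
    · exact htr _ _ _ h2 (htr _ _ _ h1 hio')
end

section
/- Let (G,≺) be a POP-graph and let ≺_V be the induced relation on V(G): v1 ≺_V v2 if and only if v1 ≠ v2 and at least one of the following holds: (1) I(v1), I(v2) are nonempty and i⁺(v1) ≺ i⁺(v2); (2) I(v1), O(v2) are nonempty and i⁺(v1) ≺ o⁻(v2); (3) O(v1), I(v2) are nonempty and o⁻(v1) ⪯ i⁺(v2); (4) O(v1), O(v2) are nonempty and o⁻(v1) ≺ o⁻(v2). Then ≺_V is a strict linear order on V(G): it is irreflexive, transitive, and any two distinct vertices are comparable. -/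
theorem ereach_out {V E : Type*} (s t : E → V) (i e : E) (h : EReach s t i e) :
    ∃ o, s o = t i ∧ (o = e ∨ EReach s t o e) := by
  obtain ⟨hne, p, hc, hl⟩ := h
  cases p with
  | nil => exact absurd (by simpa using hl) hne
  | cons o q =>
    have hc' : t i = s o ∧ EdgeChain s t (o :: q) := by
      simpa [EdgeChain, List.Chain', List.isChain_cons_cons] using hc
    refine ⟨o, hc'.1.symm, ?_⟩
    by_cases hoe : o = e
    · exact Or.inl hoe
    · exact Or.inr ⟨hoe, q, hc'.2, by simpa using hl⟩

theorem ereach_in_aux {V E : Type*} (s t : E → V) (o : E) (p : List E) :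
    ∀ e, e ≠ o → EdgeChain s t (e :: p) → (e :: p).getLast (List.cons_ne_nil _ _) = o →
    ∃ i, t i = s o ∧ ∃ q, EdgeChain s t (e :: q) ∧
      (e :: q).getLast (List.cons_ne_nil _ _) = i := by
  induction p with
  | nil => intro e hne _ hl; exact absurd (by simpa using hl) hne
  | cons f q ih =>
    intro e hne hc hl
    have hc' : t e = s f ∧ EdgeChain s t (f :: q) := by
      simpa [EdgeChain, List.Chain', List.isChain_cons_cons] using hc
    by_cases hfo : f = o
    · subst hfo
      exact ⟨e, hc'.1, [], by simp [EdgeChain, List.Chain'], by simp⟩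
    · obtain ⟨i, hi, q', hq, hq'⟩ := ih f hfo hc'.2 (by simpa using hl)
      refine ⟨i, hi, f :: q', ?_, by simpa using hq'⟩
      have := hc'.1
      simp only [EdgeChain, List.Chain'] at hq ⊢
      exact List.isChain_cons_cons.2 ⟨this, hq⟩

theorem ereach_in {V E : Type*} (s t : E → V) (e o : E) (h : EReach s t e o) :
    ∃ i, t i = s o ∧ (e = i ∨ EReach s t e i) := by
  obtain ⟨hne, p, hc, hl⟩ := h
  obtain ⟨i, hi, q, hq, hq'⟩ := ereach_in_aux s t o p e hne hc hl
  refine ⟨i, hi, ?_⟩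
  by_cases h : e = i
  · exact Or.inl h
  · exact Or.inr ⟨h, q, hq, hq'⟩

theorem exists_rank {E : Type*} [Fintype E] (prec : E → E → Prop)
    (h : IsStrictLinearOrder prec) : ∃ r : E → ℕ, (∀ x y, prec x y ↔ r x < r y) ∧
      (∀ x y, r x = r y → x = y) ∧
      (∀ x y, prec x y → (∀ z, prec x z → prec z y → False) → r y = r x + 1) := by
  classical
  obtain ⟨hi, ht, hl⟩ := h
  let r : E → ℕ := fun x => (Finset.univ.filter (fun z => prec z x)).card
  have hm : ∀ x y, prec x y → r x < r y := by
    intro x y hxy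
    apply Finset.card_lt_card
    rw [Finset.ssubset_iff_of_subset]
    · exact ⟨x, by simpa using hxy, by simpa using hi x⟩
    · intro z hz
      simp only [Finset.mem_filter, Finset.mem_univ, true_and] at hz ⊢
      exact ht _ _ _ hz hxy
  have hinj : ∀ x y, r x = r y → x = y := by
    intro x y hxy
    by_contra hne
    rcases hl x y hne with h | h
    · have := hm _ _ h; omega
    · have := hm _ _ h; omega
  refine ⟨r, ?_, hinj, ?_⟩
  · intro x y
    refine ⟨hm x y, fun hlt => ?_⟩
    by_cases hxy : x = y
    · subst hxy; omega
    · rcases hl x y hxy with h | h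
      · exact h
      · have := hm _ _ h; omega
  · intro x y hxy hno
    have : Finset.univ.filter (fun z => prec z y)
        = insert x (Finset.univ.filter (fun z => prec z x)) := by
      ext z
      simp only [Finset.mem_filter, Finset.mem_univ, true_and, Finset.mem_insert]
      constructor
      · intro hz
        by_cases hzx : z = x
        · exact Or.inl hzx
        · rcases hl z x hzx with h | h
          · exact Or.inr h
          · exact (hno z h hz).elim
      · rintro (h | h)
        · exact h ▸ hxy
        · exact ht _ _ _ h hxy
    show (Finset.univ.filter (fun z => prec z y)).card = _
    rw [this, Finset.card_insert_of_notMem (by simpa using hi x)]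

theorem consec {V E : Type*} (s t : E → V) (prec : E → E → Prop)
    (hac : Acyclic s t) (hpo : IsPlanarOrder (EReach s t) prec) (v : V) (i o : E)
    (hi : IsMaxIn prec (fun e => t e = v) i) (ho : IsMinIn prec (fun e => s e = v) o) :
    prec i o ∧ ∀ z, prec i z → prec z o → False := by
  obtain ⟨⟨hirr, htr, hlin⟩, hP1, hP2⟩ := hpo
  obtain ⟨hi1, hi2⟩ := hi
  obtain ⟨ho1, ho2⟩ := ho
  simp only at hi1 hi2 ho1 ho2
  have hio : EReach s t i o := by
    refine ⟨?_, [o], ?_, by simp⟩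
    · rintro rfl
      exact hac v ⟨i, [], by simp [EdgeChain, List.Chain'], ho1, by simpa using hi1⟩
    · simp [EdgeChain, List.Chain', hi1, ho1]
  refine ⟨hP1 _ _ hio, fun z hiz hzo => ?_⟩
  rcases hP2 _ _ _ hiz hzo hio with h | h
  · obtain ⟨o', ho', hz⟩ := ereach_out s t i z h
    have hoz : o' = z ∨ prec o' z := hz.imp_right (hP1 _ _)
    rcases ho2 o' (ho'.trans hi1) with h1 | h1 <;> rcases hoz with h2 | h2
    · subst h1 h2; exact hirr _ hzo
    · subst h1; exact hirr _ (htr _ _ _ hzo h2)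
    · subst h2; exact hirr _ (htr _ _ _ hzo h1)
    · exact hirr _ (htr _ _ _ (htr _ _ _ hzo h1) h2)
  · obtain ⟨i', hi', hz⟩ := ereach_in s t z o h
    have hoz : z = i' ∨ prec z i' := hz.imp_right (hP1 _ _)
    rcases hi2 i' (hi'.trans ho1) with h1 | h1 <;> rcases hoz with h2 | h2
    · subst h1 h2; exact hirr _ hiz
    · subst h1; exact hirr _ (htr _ _ _ hiz h2)
    · subst h2; exact hirr _ (htr _ _ _ hiz h1)
    · exact hirr _ (htr _ _ _ (htr _ _ _ hiz h2) h1)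

theorem stmt7 {V E : Type*} [Fintype V] [Fintype E] (s t : E → V)
    (prec : E → E → Prop)
    (hproc : Processive s t) (hpo : IsPlanarOrder (EReach s t) prec) :
    IsStrictLinearOrder (VPrec s t prec) := by
  classical
  obtain ⟨r, hr, hinj, hsucc⟩ := exists_rank prec hpo.1
  obtain ⟨hac, hsrc, hsnk⟩ := hproc
  have hmax : ∀ P : E → Prop, (∃ e, P e) → ∃ m, IsMaxIn prec P m := by
    rintro P ⟨e, he⟩
    obtain ⟨m, hm, hm'⟩ := Finset.exists_max_image (Finset.univ.filter P) r ⟨e, by simpa using he⟩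
    refine ⟨m, by simpa using hm, fun x hx => ?_⟩
    have := hm' x (by simpa using hx)
    rcases this.eq_or_lt with h | h
    · exact Or.inl (hinj _ _ h)
    · exact Or.inr ((hr _ _).2 h)
  have hmin : ∀ P : E → Prop, (∃ e, P e) → ∃ m, IsMinIn prec P m := by
    rintro P ⟨e, he⟩
    obtain ⟨m, hm, hm'⟩ := Finset.exists_min_image (Finset.univ.filter P) r ⟨e, by simpa using he⟩
    refine ⟨m, by simpa using hm, fun x hx => ?_⟩
    have := hm' x (by simpa using hx)
    rcases this.eq_or_lt with h | h
    · exact Or.inl (hinj _ _ h).symm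
    · exact Or.inr ((hr _ _).2 h)
  have umax : ∀ P m m', IsMaxIn prec P m → IsMaxIn prec P m' → r m = r m' := by
    intro P m m' h h'
    rcases h.2 m' h'.1 with h1 | h1
    · rw [h1]
    rcases h'.2 m h.1 with h2 | h2
    · rw [h2]
    rw [hr] at h1 h2; omega
  have umin : ∀ P m m', IsMinIn prec P m → IsMinIn prec P m' → r m = r m' := by
    intro P m m' h h'
    rcases h.2 m' h'.1 with h1 | h1
    · rw [h1]
    rcases h'.2 m h.1 with h2 | h2
    · rw [h2]
    rw [hr] at h1 h2; omega
  have hk : ∀ v, ∃ k : ℕ, (∀ i, IsMaxIn prec (fun e => t e = v) i → k = 2 * r i + 2) ∧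
      (∀ o, IsMinIn prec (fun e => s e = v) o → k = 2 * r o ∨ k = 2 * r o + 1) ∧
      ((∃ i, IsMaxIn prec (fun e => t e = v) i) ∨
        ∃ o, IsMinIn prec (fun e => s e = v) o ∧ k = 2 * r o + 1) := by
    intro v
    by_cases hI : ∃ e, t e = v
    · obtain ⟨i, hi⟩ := hmax _ hI
      refine ⟨2 * r i + 2, fun i' hi' => by rw [umax _ _ _ hi hi'], fun o ho => ?_, Or.inl ⟨i, hi⟩⟩
      obtain ⟨h1, h2⟩ := consec s t prec hac hpo v i o hi ho
      have := hsucc _ _ h1 h2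
      omega
    · have hO : ∃ e, s e = v := by
        by_contra hO
        have hd := hsrc v (fun e he => hI ⟨e, he⟩)
        have h1 : IsEmpty {e : E // s e = v} := ⟨fun e => hO ⟨e.1, e.2⟩⟩
        have h2 : IsEmpty {e : E // t e = v} := ⟨fun e => hI ⟨e.1, e.2⟩⟩
        simp [degree] at hd
      obtain ⟨o, ho⟩ := hmin _ hO
      exact ⟨2 * r o + 1, fun i hi => (hI ⟨i, hi.1⟩).elim,
        fun o' ho' => by rw [umin _ _ _ ho ho']; exact Or.inr rfl, Or.inr ⟨o, ho, rfl⟩⟩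
  choose k kI kO kE using hk
  have kinj : ∀ v w, k v = k w → v = w := by
    intro v w h
    rcases kE v with ⟨i, hi⟩ | ⟨o, ho, ho'⟩ <;> rcases kE w with ⟨i2, hi2⟩ | ⟨o2, ho2, ho2'⟩
    · have h1 := kI _ _ hi
      have h2 := kI _ _ hi2
      have : i = i2 := hinj _ _ (by omega)
      subst this
      exact hi.1.symm.trans hi2.1
    · have h1 := kI _ _ hi
      omega
    · have h2 := kI _ _ hi2
      omega
    · have : o = o2 := hinj _ _ (by omega)
      subst this
      exact ho.1.symm.trans ho2.1
  have key : ∀ v w, VPrec s t prec v w ↔ k v < k w := by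
    intro v w
    constructor
    · rintro ⟨hne, h⟩
      have hkne : k v ≠ k w := fun h => hne (kinj _ _ h)
      rcases h with ⟨a, b, ha, hb, h⟩ | ⟨a, b, ha, hb, h⟩ | ⟨a, b, ha, hb, h⟩ | ⟨a, b, ha, hb, h⟩
      · have := kI _ _ ha
        have := kI _ _ hb
        rw [hr] at h; omega
      · have := kI _ _ ha
        have := kO _ _ hb
        rw [hr] at h; omega
      · have := kO _ _ ha
        have := kI _ _ hb
        have : r a ≤ r b := by
          rcases h with h | h
          · rw [h]
          · exact ((hr _ _).1 h).le
        omega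
      · have := kO _ _ ha
        have := kO _ _ hb
        rw [hr] at h; omega
    · intro hlt
      refine ⟨fun h => by subst h; omega, ?_⟩
      rcases kE v with ⟨i, hi⟩ | ⟨o, ho, ho'⟩ <;> rcases kE w with ⟨i2, hi2⟩ | ⟨o2, ho2, ho2'⟩
      · have h1 := kI _ _ hi
        have h2 := kI _ _ hi2
        exact Or.inl ⟨i, i2, hi, hi2, (hr _ _).2 (by omega)⟩
      · have h1 := kI _ _ hi
        exact Or.inr (Or.inl ⟨i, o2, hi, ho2, (hr _ _).2 (by omega)⟩)
      · have h2 := kI _ _ hi2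
        refine Or.inr (Or.inr (Or.inl ⟨o, i2, ho, hi2, ?_⟩))
        have : r o ≤ r i2 := by omega
        rcases this.eq_or_lt with h | h
        · exact Or.inl (hinj _ _ h)
        · exact Or.inr ((hr _ _).2 h)
      · exact Or.inr (Or.inr (Or.inr ⟨o, o2, ho, ho2, (hr _ _).2 (by omega)⟩))
  refine ⟨fun x h => ?_, fun x y z h1 h2 => ?_, fun x y hne => ?_⟩
  · rw [key] at h; omega
  · rw [key] at h1 h2 ⊢; omega
  · rw [key, key]
    have : k x ≠ k y := fun h => hne (kinj _ _ h)
    omega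
end

section
/- Let (G,≺) be a POP-graph and let ≺_V be the induced relation on V(G): v1 ≺_V v2 if and only if v1 ≠ v2 and at least one of the following holds: (1) I(v1), I(v2) are nonempty and i⁺(v1) ≺ i⁺(v2); (2) I(v1), O(v2) are nonempty and i⁺(v1) ≺ o⁻(v2); (3) O(v1), I(v2) are nonempty and o⁻(v1) ⪯ i⁺(v2); (4) O(v1), O(v2) are nonempty and o⁻(v1) ≺ o⁻(v2). Then ≺_V satisfies (P1) with respect to the vertex reachability order: for all vertices v1, v2, if v1 → v2 then v1 ≺_V v2. -/
theorem stmt8_max {E : Type*} [Fintype E] (prec : E → E → Prop)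
    (h : IsStrictLinearOrder prec) (P : E → Prop) (hP : ∃ e, P e) : ∃ m, IsMaxIn prec P m := by
  obtain ⟨hi, ht, hl⟩ := h
  have : Std.Irrefl (fun a b => prec b a) := ⟨fun a => hi a⟩
  have : IsTrans E (fun a b => prec b a) := ⟨fun a b c h1 h2 => ht _ _ _ h2 h1⟩
  have wf : WellFounded (fun a b => prec b a) := Finite.wellFounded_of_trans_of_irrefl _
  obtain ⟨m, hm, hmin⟩ := wf.has_min {e | P e} hP
  refine ⟨m, hm, fun x hx => ?_⟩
  by_cases hxm : x = m
  · exact Or.inl hxm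
  · exact Or.inr ((hl x m hxm).resolve_right (hmin x hx))

theorem stmt8_min {E : Type*} [Fintype E] (prec : E → E → Prop)
    (h : IsStrictLinearOrder prec) (P : E → Prop) (hP : ∃ e, P e) : ∃ m, IsMinIn prec P m := by
  obtain ⟨hi, ht, hl⟩ := h
  have h' : IsStrictLinearOrder (fun a b => prec b a) :=
    ⟨hi, fun x y z h1 h2 => ht _ _ _ h2 h1, fun x y hxy => (hl x y hxy).symm⟩
  exact stmt8_max _ h' P hP

theorem stmt8 {V E : Type*} [Fintype V] [Fintype E] (s t : E → V)
    (prec : E → E → Prop)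
    (hproc : Processive s t) (hpo : IsPlanarOrder (EReach s t) prec) :
    ∀ v1 v2, VReach s t v1 v2 → VPrec s t prec v1 v2 := by
  intro v1 v2 hr
  refine ⟨fun h => hproc.1 v1 (by rw [← h] at hr; exact hr), Or.inr (Or.inr (Or.inl ?_))⟩
  obtain ⟨hlin, hp1, -⟩ := hpo
  obtain ⟨e, p, hc, hs, ht⟩ := hr
  obtain ⟨o, ho⟩ := stmt8_min prec hlin (fun e => s e = v1) ⟨e, hs⟩
  obtain ⟨i, hi⟩ := stmt8_max prec hlin (fun e => t e = v2) ⟨_, ht⟩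
  have tr : ∀ a b c, WeakPrec prec a b → WeakPrec prec b c → WeakPrec prec a c := by
    rintro a b c (rfl | h1) (rfl | h2)
    · exact Or.inl rfl
    · exact Or.inr h2
    · exact Or.inr h1
    · exact Or.inr (hlin.2.1 _ _ _ h1 h2)
  refine ⟨o, i, ho, hi, tr _ e _ ?_ (tr _ _ _ ?_ (hi.2 _ ht))⟩
  · exact (ho.2 e hs).imp Eq.symm id
  · by_cases h : e = (e :: p).getLast (List.cons_ne_nil _ _)
    · exact Or.inl h
    · exact Or.inr (hp1 _ _ ⟨h, p, hc, rfl⟩)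
end

section
/- Let (G,≺) be a POP-graph and let ≺_V be the induced relation on V(G): v1 ≺_V v2 if and only if v1 ≠ v2 and at least one of the following holds: (1) I(v1), I(v2) are nonempty and i⁺(v1) ≺ i⁺(v2); (2) I(v1), O(v2) are nonempty and i⁺(v1) ≺ o⁻(v2); (3) O(v1), I(v2) are nonempty and o⁻(v1) ⪯ i⁺(v2); (4) O(v1), O(v2) are nonempty and o⁻(v1) ≺ o⁻(v2). Then ≺_V satisfies (P2) with respect to the vertex reachability order: for all vertices v1, v2, v3, if v1 ≺_V v2 ≺_V v3 and v1 → v3, then v1 → v2 or v2 → v3. -/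
namespace POP

/-- Reflexive path relation on edges. -/
def RR {V E : Type*} (s t : E → V) : E → E → Prop :=
  Relation.ReflTransGen (fun a b => t a = s b)

theorem rr_iff {V E : Type*} (s t : E → V) (e f : E) :
    (∃ p : List E, EdgeChain s t (e :: p) ∧
      (e :: p).getLast (List.cons_ne_nil _ _) = f) ↔ RR s t e f := by
  constructor
  · rintro ⟨p, hp, hl⟩
    exact List.relationReflTransGen_of_exists_isChain_cons p hp hl
  · intro h
    exact List.exists_isChain_cons_of_relationReflTransGen h

theorem vreach_iff {V E : Type*} (s t : E → V) (v w : V) :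
    VReach s t v w ↔ ∃ e f, s e = v ∧ t f = w ∧ RR s t e f := by
  constructor
  · rintro ⟨e, p, hp, hs, ht⟩
    exact ⟨e, _, hs, ht, (rr_iff s t _ _).1 ⟨p, hp, rfl⟩⟩
  · rintro ⟨e, f, hs, ht, h⟩
    obtain ⟨p, hp, hl⟩ := (rr_iff s t _ _).2 h
    exact ⟨e, p, hp, hs, by rw [hl]; exact ht⟩

theorem exists_max {E : Type*} [Finite E] (prec : E → E → Prop)
    (h : IsStrictLinearOrder prec) (P : E → Prop) (x : E) (hx : P x) :
    ∃ m, IsMaxIn prec P m := by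
  obtain ⟨h1, h2, h3⟩ := h
  let r : E → E → Prop := fun a b => prec b a
  haveI : IsTrans E r := ⟨fun a b c hab hbc => h2 _ _ _ hbc hab⟩
  haveI : Std.Irrefl r := ⟨fun a => h1 a⟩
  obtain ⟨m, hm, hmin⟩ := (Finite.wellFounded_of_trans_of_irrefl r).has_min {x | P x} ⟨x, hx⟩
  refine ⟨m, hm, fun y hy => ?_⟩
  by_contra hc
  push Not at hc
  rcases h3 y m hc.1 with h | h
  · exact hc.2 h
  · exact hmin y hy h

theorem exists_min {E : Type*} [Finite E] (prec : E → E → Prop)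
    (h : IsStrictLinearOrder prec) (P : E → Prop) (x : E) (hx : P x) :
    ∃ m, IsMinIn prec P m := by
  obtain ⟨h1, h2, h3⟩ := h
  obtain ⟨m, hm, h⟩ := exists_max (fun a b => prec b a)
    ⟨h1, fun a b c hab hbc => h2 _ _ _ hbc hab, fun a b hab => (h3 a b hab).symm⟩ P x hx
  exact ⟨m, hm, h⟩

theorem max_unique {E : Type*} {prec : E → E → Prop}
    (h : IsStrictLinearOrder prec) {P : E → Prop} {x y : E} (hx : IsMaxIn prec P x)
    (hy : IsMaxIn prec P y) : x = y := by
  obtain ⟨h1, h2, h3⟩ := h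
  rcases hx.2 y hy.1 with h | h
  · exact h.symm
  · rcases hy.2 x hx.1 with h' | h'
    · exact h'
    · exact (h1 _ (h2 _ _ _ h h')).elim

theorem min_unique {E : Type*} {prec : E → E → Prop}
    (h : IsStrictLinearOrder prec) {P : E → Prop} {x y : E} (hx : IsMinIn prec P x)
    (hy : IsMinIn prec P y) : x = y := by
  obtain ⟨h1, h2, h3⟩ := h
  rcases hx.2 y hy.1 with h | h
  · exact h.symm
  · rcases hy.2 x hx.1 with h' | h'
    · exact h'
    · exact (h1 _ (h2 _ _ _ h h')).elim

/-- Planarity, in terms of `RR`. -/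
def Pl {V E : Type*} (s t : E → V) (prec : E → E → Prop) : Prop :=
  IsStrictLinearOrder prec ∧ (∀ x y, RR s t x y → x = y ∨ prec x y) ∧
    (∀ x y, t x = s y → prec x y) ∧
    ∀ x1 x2 x3, prec x1 x2 → prec x2 x3 → RR s t x1 x3 → RR s t x1 x2 ∨ RR s t x2 x3

theorem pl_of {V E : Type*} {s t : E → V} {prec : E → E → Prop}
    (ha : Acyclic s t) (h : IsPlanarOrder (EReach s t) prec) : Pl s t prec := by
  obtain ⟨hl, hp1, hp2⟩ := h
  have key : ∀ x y, RR s t x y → x = y ∨ prec x y := by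
    intro x y hxy
    by_cases e : x = y
    · exact Or.inl e
    · exact Or.inr (hp1 _ _ ⟨e, (rr_iff s t x y).2 hxy⟩)
  refine ⟨hl, key, ?_, ?_⟩
  · intro x y hxy
    rcases key x y (Relation.ReflTransGen.single hxy) with h | h
    · subst h
      exact (ha (s x) ((vreach_iff s t _ _).2
        ⟨x, x, rfl, hxy, Relation.ReflTransGen.refl⟩)).elim
    · exact h
  · intro x1 x2 x3 h12 h23 h13
    have hne : x1 ≠ x3 := by
      rintro rfl
      exact hl.1 _ (hl.2.1 _ _ _ h12 h23)
    rcases hp2 x1 x2 x3 h12 h23 ⟨hne, (rr_iff s t _ _).2 h13⟩ with h | h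
    · exact Or.inl ((rr_iff s t _ _).1 h.2)
    · exact Or.inr ((rr_iff s t _ _).1 h.2)

theorem pl_dual {V E : Type*} {s t : E → V} {prec : E → E → Prop}
    (h : Pl s t prec) : Pl t s (fun a b => prec b a) := by
  have sw : ∀ x y, RR t s x y → RR s t y x := by
    intro x y hxy
    induction hxy with
    | refl => exact Relation.ReflTransGen.refl
    | tail _ hbc ih => exact Relation.ReflTransGen.head hbc.symm ih
  have sw' : ∀ x y, RR s t x y → RR t s y x := by
    intro x y hxy
    induction hxy with
    | refl => exact Relation.ReflTransGen.refl
    | tail _ hbc ih => exact Relation.ReflTransGen.head hbc.symm ih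
  obtain ⟨⟨h1, h2, h3⟩, k1, k2, k3⟩ := h
  refine ⟨⟨h1, fun a b c hab hbc => h2 _ _ _ hbc hab, fun a b hab => (h3 a b hab).symm⟩,
    ?_, ?_, ?_⟩
  · intro x y hxy
    rcases k1 _ _ (sw _ _ hxy) with h | h
    · exact Or.inl h.symm
    · exact Or.inr h
  · intro x y hxy
    exact k2 _ _ hxy.symm
  · intro x1 x2 x3 h12 h23 h13
    rcases k3 _ _ _ h23 h12 (sw _ _ h13) with h | h
    · exact Or.inr (sw' _ _ h)
    · exact Or.inl (sw' _ _ h)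

theorem rr_swap {V E : Type*} {s t : E → V} {x y : E} (hxy : RR t s x y) : RR s t y x := by
  induction hxy with
  | refl => exact Relation.ReflTransGen.refl
  | tail _ hbc ih => exact Relation.ReflTransGen.head hbc.symm ih

theorem rr_head {V E : Type*} {s t : E → V} {x y : E} (h : RR s t x y) :
    x = y ∨ ∃ g, s g = t x ∧ RR s t g y := by
  rcases Relation.ReflTransGen.cases_head h with h | ⟨g, hg, h⟩
  · exact Or.inl h
  · exact Or.inr ⟨g, hg.symm, h⟩

theorem rr_tail {V E : Type*} {s t : E → V} {x y : E} (h : RR s t x y) :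
    x = y ∨ ∃ g, t g = s y ∧ RR s t x g := by
  rcases Relation.ReflTransGen.cases_tail h with h | ⟨g, h, hg⟩
  · exact Or.inl h.symm
  · exact Or.inr ⟨g, hg, h⟩

/-- No edge lies strictly between `i⁺(v)` and `o⁻(v)`. -/
theorem adjacent {V E : Type*} {s t : E → V} {prec : E → E → Prop}
    (h : Pl s t prec) {v : V} {i o : E} (hi : IsMaxIn prec (fun e => t e = v) i)
    (ho : IsMinIn prec (fun e => s e = v) o) (x : E) :
    WeakPrec prec x i ∨ WeakPrec prec o x := by
  obtain ⟨⟨h1, h2, h3⟩, k1, k2, k3⟩ := h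
  by_cases e1 : x = i
  · exact Or.inl (Or.inl e1)
  by_cases e2 : o = x
  · exact Or.inr (Or.inl e2)
  rcases h3 x i e1 with c1 | c1
  · exact Or.inl (Or.inr c1)
  rcases h3 o x e2 with c2 | c2
  · exact Or.inr (Or.inr c2)
  have hio : t i = s o := hi.1.trans ho.1.symm
  rcases k3 i x o c1 c2 (Relation.ReflTransGen.single hio) with r | r
  · rcases rr_head r with r | ⟨g, hg, r⟩
    · exact (e1 r.symm).elim
    · have a := ho.2 g (hg.trans hi.1)
      have b := k1 _ _ r
      right
      unfold WeakPrec
      grind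
  · rcases rr_tail r with r | ⟨g, hg, r⟩
    · exact (e2 r.symm).elim
    · have a := hi.2 g (hg.trans ho.1)
      have b := k1 _ _ r
      left
      unfold WeakPrec
      grind

theorem lemA {V E : Type*} [Finite E] {s t : E → V} {prec : E → E → Prop}
    (h : Pl s t prec) {v : V}
    (hu : (∀ e, t e ≠ v) → ∀ a b, s a = v → s b = v → a = b)
    {o x e : E} (ho : IsMinIn prec (fun e => s e = v) o) (hox : WeakPrec prec o x)
    (he : s e = v) : prec e x ∨ ∃ g, s g = v ∧ RR s t g x := by
  by_cases hex : e = x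
  · subst hex
    exact Or.inr ⟨e, he, Relation.ReflTransGen.refl⟩
  rcases h.1.2.2 e x hex with c | c
  · exact Or.inl c
  right
  rcases hox with rfl | hox
  · exact ⟨o, ho.1, Relation.ReflTransGen.refl⟩
  by_cases hn : ∀ e, t e ≠ v
  · have := hu hn e o he ho.1
    subst this
    exact (h.1.1 _ (h.1.2.1 _ _ _ c hox)).elim
  push Not at hn
  obtain ⟨i0, hi0⟩ := hn
  obtain ⟨i, hi⟩ := exists_max prec h.1 (fun e => t e = v) i0 hi0
  obtain ⟨⟨h1, h2, h3⟩, k1, k2, k3⟩ := h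
  have hio : prec i o := k2 _ _ (hi.1.trans ho.1.symm)
  rcases k3 i x e (h2 _ _ _ hio hox) c
    (Relation.ReflTransGen.single (hi.1.trans he.symm)) with r | r
  · rcases rr_head r with r | ⟨g, hg, r⟩
    · subst r
      exact (h1 _ (h2 _ _ _ hio hox)).elim
    · exact ⟨g, hg.trans hi.1, r⟩
  · rcases rr_tail r with r | ⟨g, hg, r⟩
    · exact (hex r.symm).elim
    · have a := hi.2 g (hg.trans he)
      have b := k1 _ _ r
      exfalso
      grind

theorem lemB {V E : Type*} [Finite E] {s t : E → V} {prec : E → E → Prop}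
    (h : Pl s t prec) {v : V}
    (hu : (∀ e, s e ≠ v) → ∀ a b, t a = v → t b = v → a = b)
    {i x f : E} (hi : IsMaxIn prec (fun e => t e = v) i) (hxi : WeakPrec prec x i)
    (hf : t f = v) : prec x f ∨ ∃ g, t g = v ∧ RR s t x g := by
  rcases lemA (pl_dual h) hu (o := i) (x := x) (e := f) hi
    (hxi.imp Eq.symm id) hf with r | ⟨g, hg, r⟩
  · exact Or.inl r
  · exact Or.inr ⟨g, hg, rr_swap r⟩

theorem uniq_out {V E : Type*} [Fintype E] {s t : E → V} {v : V}
    (hd : degree s t v = 1) (hn : ∀ e, t e ≠ v) :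
    ∀ a b, s a = v → s b = v → a = b := by
  intro a b ha hb
  haveI : IsEmpty {e : E // t e = v} := ⟨fun e => hn e.1 e.2⟩
  unfold degree at hd
  rw [Nat.card_of_isEmpty (α := {e : E // t e = v}), add_zero] at hd
  haveI := (Nat.card_eq_one_iff_unique.1 hd).1
  exact congrArg Subtype.val (Subsingleton.elim (⟨a, ha⟩ : {e : E // s e = v}) ⟨b, hb⟩)

theorem uniq_in {V E : Type*} [Fintype E] {s t : E → V} {v : V}
    (hd : degree s t v = 1) (hn : ∀ e, s e ≠ v) :
    ∀ a b, t a = v → t b = v → a = b := by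
  refine uniq_out (s := t) (t := s) ?_ hn
  unfold degree at hd ⊢
  omega

/-- Combination of the two one-sided lemmas for an edge `x` incident to `v2`. -/
theorem combine {V E : Type*} [Fintype E] {s t : E → V} {prec : E → E → Prop}
    (hproc : Processive s t) (h : Pl s t prec) {v1 v3 : V} {o x i : E}
    (ho : IsMinIn prec (fun e => s e = v1) o) (hi : IsMaxIn prec (fun e => t e = v3) i)
    (hox : WeakPrec prec o x) (hxi : WeakPrec prec x i) (hr : VReach s t v1 v3) :
    (∃ g, s g = v1 ∧ RR s t g x) ∨ ∃ g, t g = v3 ∧ RR s t x g := by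
  obtain ⟨e, f, he, hf, hef⟩ := (vreach_iff s t _ _).1 hr
  rcases lemA h (fun hn => uniq_out (hproc.2.1 v1 hn) hn) ho hox he with a | a
  · rcases lemB h (fun hn => uniq_in (hproc.2.2 v3 hn) hn) hi hxi hf with b | b
    · rcases h.2.2.2 e x f a b hef with r | r
      · exact Or.inl ⟨e, he, r⟩
      · exact Or.inr ⟨f, hf, r⟩
    · exact Or.inr b
  · exact Or.inl a

end POP

open POP

theorem stmt9 {V E : Type*} [Fintype V] [Fintype E] (s t : E → V)
    (prec : E → E → Prop)
    (hproc : Processive s t) (hpo : IsPlanarOrder (EReach s t) prec) :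
    ∀ v1 v2 v3, VPrec s t prec v1 v2 → VPrec s t prec v2 v3 →
      VReach s t v1 v3 → VReach s t v1 v2 ∨ VReach s t v2 v3 := by
  intro v1 v2 v3 h12 h23 hr
  have h := pl_of hproc.1 hpo
  have hl := h.1
  obtain ⟨e, f, he, hf, hef⟩ := (vreach_iff s t _ _).1 hr
  obtain ⟨o1, ho1⟩ := exists_min prec hl (fun e => s e = v1) e he
  obtain ⟨i3, hi3⟩ := exists_max prec hl (fun e => t e = v3) f hf
  obtain ⟨n12, h12⟩ := h12
  obtain ⟨n23, h23⟩ := h23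
  have irr := hl.1
  have tr := hl.2.1
  by_cases hi2 : ∃ i2, IsMaxIn prec (fun e => t e = v2) i2
  · obtain ⟨i2, hi2⟩ := hi2
    have A : WeakPrec prec o1 i2 := by
      rcases h12 with ⟨a, b, ha, hb, hab⟩ | ⟨a, b, ha, hb, hab⟩ | ⟨a, b, ha, hb, hab⟩ |
        ⟨a, b, ha, hb, hab⟩
      · have := max_unique hl hb hi2
        subst this
        have := adjacent h ha ho1 b
        unfold WeakPrec at *
        grind
      · have q := adjacent h hi2 hb a
        have ne : a ≠ i2 := fun e => n12 (ha.1.symm.trans ((congrArg t e).trans hi2.1))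
        have := adjacent h ha ho1 i2
        unfold WeakPrec at *
        grind
      · have := max_unique hl hb hi2
        have := min_unique hl ha ho1
        subst_vars
        exact hab
      · have := min_unique hl ha ho1
        subst this
        have := adjacent h hi2 hb a
        unfold WeakPrec at *
        grind
    have B : WeakPrec prec i2 i3 := by
      rcases h23 with ⟨a, b, ha, hb, hab⟩ | ⟨a, b, ha, hb, hab⟩ | ⟨a, b, ha, hb, hab⟩ |
        ⟨a, b, ha, hb, hab⟩
      · have := max_unique hl ha hi2
        have := max_unique hl hb hi3
        subst_vars
        exact Or.inr hab
      · have := max_unique hl ha hi2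
        subst this
        have := adjacent h hi3 hb a
        unfold WeakPrec at *
        grind
      · have := max_unique hl hb hi3
        subst this
        have := h.2.2.1 i2 a (hi2.1.trans ha.1.symm)
        unfold WeakPrec at *
        grind
      · have q := h.2.2.1 i2 a (hi2.1.trans ha.1.symm)
        have := adjacent h hi3 hb i2
        unfold WeakPrec at *
        grind
    rcases combine hproc h ho1 hi3 A B hr with ⟨g, hg, r⟩ | ⟨g, hg, r⟩
    · exact Or.inl ((vreach_iff s t _ _).2 ⟨g, i2, hg, hi2.1, r⟩)
    · rcases rr_head r with r | ⟨k, hk, r⟩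
      · subst r
        exact (n23 (hi2.1.symm.trans hg)).elim
      · exact Or.inr ((vreach_iff s t _ _).2 ⟨k, g, hk.trans hi2.1, hg, r⟩)
  · have hx : ∃ o2, IsMinIn prec (fun e => s e = v2) o2 ∧ WeakPrec prec o1 o2 := by
      rcases h12 with ⟨a, b, ha, hb, hab⟩ | ⟨a, b, ha, hb, hab⟩ | ⟨a, b, ha, hb, hab⟩ |
        ⟨a, b, ha, hb, hab⟩
      · exact (hi2 ⟨b, hb⟩).elim
      · refine ⟨b, hb, ?_⟩
        have := adjacent h ha ho1 b
        unfold WeakPrec at *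
        grind
      · exact (hi2 ⟨b, hb⟩).elim
      · have := min_unique hl ha ho1
        subst this
        exact ⟨b, hb, Or.inr hab⟩
    obtain ⟨o2, ho2, A⟩ := hx
    have B : WeakPrec prec o2 i3 := by
      rcases h23 with ⟨a, b, ha, hb, hab⟩ | ⟨a, b, ha, hb, hab⟩ | ⟨a, b, ha, hb, hab⟩ |
        ⟨a, b, ha, hb, hab⟩
      · exact (hi2 ⟨a, ha⟩).elim
      · exact (hi2 ⟨a, ha⟩).elim
      · have := max_unique hl hb hi3
        have := min_unique hl ha ho2
        subst_vars
        exact hab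
      · have := min_unique hl ha ho2
        subst this
        have := adjacent h hi3 hb a
        unfold WeakPrec at *
        grind
    rcases combine hproc h ho1 hi3 A B hr with ⟨g, hg, r⟩ | ⟨g, hg, r⟩
    · rcases rr_tail r with r | ⟨k, hk, r⟩
      · subst r
        exact (n12 (hg.symm.trans ho2.1)).elim
      · exact Or.inl ((vreach_iff s t _ _).2 ⟨g, k, hg, hk.trans ho2.1, r⟩)
    · exact Or.inr ((vreach_iff s t _ _).2 ⟨o2, g, ho2.1, hg, r⟩)
end
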